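/- There exists a constant K > 0 (one may take K = 8/ln 2) such that for every Sturmian word u and every n ≥ 2, PL_u(n) ≤ K · ln n. -/

import Mathlib

/-- The morphism ψ_b on letters: ψ_b(0) = 1·0^{b-1}, ψ_b(1) = 1·0^b
    (letters: `false` = 0, `true` = 1). -/
def psiL (b : ℕ) : Bool → List Bool
  | false => true :: List.replicate (b - 1) false
  | true  => true :: List.replicate b false

/-- The morphism ψ_b extended to words. -/
def psiW (b : ℕ) (v : List Bool) : List Bool := v.flatMap (psiL b)

/-- A palindrome is a word equal to its reversal. -/
def IsPal {A : Type*} (w : List A) : Prop := w.reverse = w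

/-- Palindromic length: minimal number of palindromes concatenating to `w`. -/
noncomputable def palLen {A : Type*} (w : List A) : ℕ :=
  sInf {k | ∃ l : List (List A), l.length = k ∧ (∀ p ∈ l, IsPal p) ∧ l.flatten = w}

/-- `v` is a factor of the infinite word `u`. -/
def FactorOf {A : Type*} (v : List A) (u : ℕ → A) : Prop :=
  ∃ i, v = (List.range v.length).map (fun k => u (i + k))

/-- A Sturmian word: exactly `n+1` factors of each length `n`. -/
def Sturmian (u : ℕ → Bool) : Prop :=
  ∀ n, Set.ncard {v : List Bool | v.length = n ∧ FactorOf v u} = n + 1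

/-- `u` has slope `α`: the frequency of the letter 1 (= `true`) is `α`. -/
def HasSlope (u : ℕ → Bool) (α : ℝ) : Prop :=
  Filter.Tendsto (fun n => (((List.range n).map u).count true : ℝ) / n)
    Filter.atTop (nhds α)

/-- The image of an infinite word under ψ_b. -/
noncomputable def psiInf (b : ℕ) (u : ℕ → Bool) : ℕ → Bool :=
  fun k => (((List.range (k + 1)).map u).flatMap (psiL b)).getD k false

/-- PL_u(n): maximal palindromic length of factors of length `n` of `u`. -/
noncomputable def PL (u : ℕ → Bool) (n : ℕ) : ℕ :=
  sSup {k | ∃ v : List Bool, v.length = n ∧ FactorOf v u ∧ palLen v = k}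

/-! ### Factorisations into few palindromes -/

/-- `w` is a concatenation of at most `k` palindromes. -/
def IsPalConcat {A : Type*} (w : List A) (k : ℕ) : Prop :=
  ∃ l : List (List A), l.length ≤ k ∧ (∀ p ∈ l, IsPal p) ∧ l.flatten = w

theorem IsPalConcat.palLen_le {A : Type*} {w : List A} {k : ℕ} (h : IsPalConcat w k) :
    palLen w ≤ k := by
  obtain ⟨l, hk, hp, hw⟩ := h
  unfold palLen
  exact le_trans (Nat.sInf_le ⟨l, rfl, hp, hw⟩) hk

theorem IsPalConcat.mono {A : Type*} {w : List A} {k m : ℕ} (h : IsPalConcat w k) (hkm : k ≤ m) :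
    IsPalConcat w m := by
  obtain ⟨l, hk, h⟩ := h
  exact ⟨l, hk.trans hkm, h⟩

theorem IsPalConcat.append {A : Type*} {v w : List A} {k m : ℕ} (hv : IsPalConcat v k)
    (hw : IsPalConcat w m) : IsPalConcat (v ++ w) (k + m) := by
  obtain ⟨l, hk, hl, rfl⟩ := hv
  obtain ⟨l', hm, hl', rfl⟩ := hw
  refine ⟨l ++ l', by simp; omega, ?_, by simp⟩
  intro p hp
  rcases List.mem_append.1 hp with h | h
  exacts [hl p h, hl' p h]

theorem IsPal.isPalConcat {A : Type*} {w : List A} (h : IsPal w) : IsPalConcat w 1 :=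
  ⟨[w], by simp, by simpa using h, by simp⟩

theorem IsPalConcat.map {A B : Type*} (f : A → B) {w : List A} {k : ℕ} (h : IsPalConcat w k) :
    IsPalConcat (w.map f) k := by
  obtain ⟨l, hk, hl, rfl⟩ := h
  refine ⟨l.map (List.map f), by simpa using hk, ?_, by rw [List.map_flatten]⟩
  intro p hp
  obtain ⟨q, hq, rfl⟩ := List.mem_map.1 hp
  have := hl q hq
  unfold IsPal at *
  rw [← List.map_reverse, this]

theorem isPal_replicate {A : Type*} (n : ℕ) (a : A) : IsPal (List.replicate n a) := by
  simp [IsPal]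

/-! ### The morphism `psiW` and palindromes -/

@[simp] theorem psiW_nil (b : ℕ) : psiW b [] = [] := rfl

theorem psiW_append (b : ℕ) (v w : List Bool) : psiW b (v ++ w) = psiW b v ++ psiW b w := by
  simp [psiW]

theorem psiW_cons (b : ℕ) (x : Bool) (w : List Bool) : psiW b (x :: w) = psiL b x ++ psiW b w := by
  simp [psiW]

theorem psiL_eq_cons (b : ℕ) (x : Bool) : ∃ k, psiL b x = true :: List.replicate k false := by
  cases x
  exacts [⟨_, rfl⟩, ⟨_, rfl⟩]

/-- The conjugate of `psiW b` by the letter `1`. -/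
def psiConj (b : ℕ) (v : List Bool) : List Bool := v.flatMap fun x => (psiL b x).reverse

theorem psiConj_append (b : ℕ) (v w : List Bool) :
    psiConj b (v ++ w) = psiConj b v ++ psiConj b w := by
  simp [psiConj]

theorem psiW_append_true (b : ℕ) (v : List Bool) : psiW b v ++ [true] = true :: psiConj b v := by
  induction v with
  | nil => simp [psiConj]
  | cons x v ih =>
    obtain ⟨k, hk⟩ := psiL_eq_cons b x
    rw [psiW_cons, List.append_assoc, ih]
    simp [psiConj, hk]

theorem reverse_psiW (b : ℕ) (v : List Bool) : (psiW b v).reverse = psiConj b v.reverse := by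
  simp [psiW, psiConj, List.reverse_flatMap, Function.comp_def]

theorem IsPal.psiW_append_true {b : ℕ} {p : List Bool} (h : IsPal p) :
    IsPal (psiW b p ++ [true]) := by
  have h' : p.reverse = p := h
  unfold IsPal
  rw [List.reverse_append, reverse_psiW, h', _root_.psiW_append_true]
  rfl

theorem psiW_isPalConcat_aux (b : ℕ) (l : List (List Bool)) (hl : ∀ p ∈ l, IsPal p) :
    IsPalConcat (psiW b l.flatten ++ [true]) (l.length + 1) ∧
      IsPalConcat (psiConj b l.flatten) (l.length + 1) := by
  induction l with
  | nil => exact ⟨IsPal.isPalConcat rfl, IsPal.isPalConcat rfl⟩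
  | cons p l ih =>
    obtain ⟨hA, hB⟩ := ih fun q hq => hl q (List.mem_cons_of_mem _ hq)
    have hp : IsPal p := hl p List.mem_cons_self
    rw [List.flatten_cons, psiW_append, psiConj_append, List.length_cons]
    constructor
    · have := hp.psiW_append_true (b := b) |>.isPalConcat.append hB
      rw [List.append_assoc, List.singleton_append, ← psiW_append_true] at this
      rw [List.append_assoc]
      exact this.mono (by omega)
    · rcases p with _ | ⟨x, p⟩
      · exact hB.mono (by omega)
      obtain ⟨k, hk⟩ := psiL_eq_cons b x
      have hpal := hp.psiW_append_true (b := b)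
      have hq := psiW_append_true b (x :: p)
      rw [psiW_cons, hk, List.cons_append, List.cons_append, List.cons.injEq] at hq
      rw [psiW_cons, hk] at hpal
      have hq' : IsPal (List.replicate k false ++ psiW b p) := by
        simp only [IsPal, List.reverse_append, List.reverse_cons, List.cons_append,
          List.append_assoc, List.reverse_nil, List.nil_append, List.cons.injEq, true_and,
          List.reverse_replicate] at hpal ⊢
        simp only [← List.append_assoc] at hpal
        exact List.append_cancel_right hpal
      have := hq'.isPalConcat.append hA
      rw [← hq.2, List.append_assoc, List.singleton_append, ← psiW_append_true]
      exact this.mono (by omega)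

theorem IsPalConcat.psiW_append_true {b k : ℕ} {v : List Bool} (h : IsPalConcat v k) :
    IsPalConcat (psiW b v ++ [true]) (k + 1) := by
  obtain ⟨l, hk, hl, rfl⟩ := h
  exact (psiW_isPalConcat_aux b l hl).1.mono (by omega)

/-! ### Finite words without a pair of factors `0z0`, `1z1` -/

/-- No word `z` has both `0z0` and `1z1` among the factors of `w`. -/
def NoConflict (w : List Bool) : Prop :=
  ∀ z : List Bool, false :: (z ++ [false]) <:+: w → true :: (z ++ [true]) <:+: w → False

theorem NoConflict.map_not {w : List Bool} (h : NoConflict w) : NoConflict (w.map not) := by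
  intro z h0 h1
  have h0' := h0.map not
  have h1' := h1.map not
  simp only [List.map_cons, List.map_append, List.map_nil, List.map_map, Bool.not_false,
    Bool.not_true, Function.comp_def, Bool.not_not, List.map_id_fun'] at h0' h1'
  exact h _ h1' h0'

theorem NoConflict.of_infix {v w : List Bool} (h : NoConflict w) (hv : v <:+: w) :
    NoConflict v :=
  fun z h0 h1 => h z (h0.trans hv) (h1.trans hv)

theorem NoConflict.of_psiW {b : ℕ} {v : List Bool}
    (h : NoConflict (psiW (b + 1) v ++ [true])) : NoConflict v := by
  rintro z ⟨s, t, hst⟩ ⟨s', t', hst'⟩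
  have hcomm (x : List Bool) : List.replicate b false ++ false :: x =
      false :: (List.replicate b false ++ x) := by
    rw [List.append_cons, ← List.replicate_succ', List.replicate_succ, List.cons_append]
  refine h (List.replicate b false ++ psiW (b + 1) z ++ true :: List.replicate b false) ?_ ?_
  · refine ⟨psiW (b + 1) s' ++ [true], psiW (b + 1) t' ++ [true], ?_⟩
    rw [← hst']
    simp [psiW_append, psiW_cons, psiL, List.replicate_succ, hcomm]
  · refine ⟨psiW (b + 1) s, psiConj (b + 1) t, ?_⟩
    rw [← hst]
    simp [psiW_append, psiW_cons, psiL, psiW_append_true]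

/-! ### Block decomposition -/

/-- The concatenation of the blocks `1 0^c` for `c` in the list. -/
def blocks (bs : List ℕ) : List Bool := bs.flatMap fun c => true :: List.replicate c false

theorem exists_blocks (w : List Bool) :
    (∃ s, w = List.replicate s false) ∨
      ∃ s bs r, w = List.replicate s false ++ (blocks bs ++ [true]) ++ List.replicate r false := by
  induction w with
  | nil => exact Or.inl ⟨0, rfl⟩
  | cons x w ih =>
    rcases ih with ⟨s, rfl⟩ | ⟨s, bs, r, rfl⟩ <;> cases x
    · exact Or.inl ⟨s + 1, by simp [List.replicate_succ]⟩
    · exact Or.inr ⟨0, [], s, by simp [blocks]⟩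
    · exact Or.inr ⟨s + 1, bs, r, by simp [List.replicate_succ]⟩
    · exact Or.inr ⟨0, s :: bs, r, by simp [blocks]⟩

theorem infix_blocks_of_mem {bs : List ℕ} {c : ℕ} (h : c ∈ bs) :
    true :: (List.replicate c false ++ [true]) <:+: blocks bs ++ [true] := by
  obtain ⟨s, t, rfl⟩ := List.append_of_mem h
  have ht : ∃ t', blocks t ++ [true] = true :: t' := by
    cases t with
    | nil => exact ⟨[], rfl⟩
    | cons d t => exact ⟨_, rfl⟩
  obtain ⟨t', ht'⟩ := ht
  refine ⟨blocks s, t', ?_⟩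
  have : blocks (s ++ c :: t) = blocks s ++ (true :: List.replicate c false ++ blocks t) := by
    simp [blocks]
  simp [this, ht']

theorem two_mul_length_le_length_blocks {bs : List ℕ} (h : ∀ c ∈ bs, c ≠ 0) :
    2 * bs.length ≤ (blocks bs).length := by
  induction bs with
  | nil => simp
  | cons c bs ih =>
    have h1 := ih fun d hd => h d (List.mem_cons_of_mem _ hd)
    have h2 := h c List.mem_cons_self
    have : (blocks (c :: bs)).length = c + 1 + (blocks bs).length := by
      simp [blocks]
      omega
    rw [this, List.length_cons]
    omega

theorem NoConflict.exists_block_lengths {bs : List ℕ} (h : NoConflict (blocks bs ++ [true])) :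
    ∃ b, ∀ c ∈ bs, c = b ∨ c = b + 1 := by
  rcases bs.eq_nil_or_concat with rfl | hne
  · exact ⟨0, by simp⟩
  have hex : ∃ b, b ∈ bs := by
    obtain ⟨l, a, rfl⟩ := hne
    exact ⟨a, by simp⟩
  classical
  refine ⟨Nat.find hex, fun c hc => ?_⟩
  have hmin := Nat.find_min' hex hc
  have hmem := Nat.find_spec hex
  generalize Nat.find hex = b at hmin hmem
  by_contra hcon
  refine h (List.replicate b false) ?_ (infix_blocks_of_mem hmem)
  refine List.IsInfix.trans ?_ (infix_blocks_of_mem hc)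
  obtain ⟨d, rfl⟩ : ∃ d, c = b + 2 + d := ⟨c - (b + 2), by omega⟩
  refine ⟨[true], List.replicate d false ++ [true], ?_⟩
  have hrep : List.replicate (b + 2 + d) false =
      false :: (List.replicate b false ++ [false]) ++ List.replicate d false := by
    rw [← List.replicate_succ', ← List.replicate_succ, List.replicate_append_replicate]
  simp [hrep]

theorem psiW_map_eq_blocks {bs : List ℕ} {b : ℕ} (h : ∀ c ∈ bs, c = b ∨ c = b + 1) :
    psiW (b + 1) (bs.map fun c => decide (c = b + 1)) = blocks bs := by
  induction bs with
  | nil => rfl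
  | cons c bs ih =>
    have h1 := ih fun d hd => h d (List.mem_cons_of_mem _ hd)
    rw [List.map_cons, psiW_cons, h1]
    rcases h c List.mem_cons_self with rfl | rfl <;> simp [blocks, psiL]

/-- One desubstitution step: the length is halved at the cost of three palindromes. -/
theorem NoConflict.isPalConcat_step {w : List Bool} {N k : ℕ} (h : NoConflict w)
    (h11 : ¬ [true, true] <:+: w) (hw : w.length ≤ 2 * N)
    (ih : ∀ v : List Bool, NoConflict v → v.length ≤ N → IsPalConcat v k) :
    IsPalConcat w (k + 3) := by
  rcases exists_blocks w with ⟨s, rfl⟩ | ⟨s, bs, r, rfl⟩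
  · exact (isPal_replicate s false).isPalConcat.mono (by omega)
  have hin : blocks bs ++ [true] <:+:
      List.replicate s false ++ (blocks bs ++ [true]) ++ List.replicate r false := ⟨_, _, rfl⟩
  have hbs := h.of_infix hin
  have hpos : ∀ c ∈ bs, c ≠ 0 := by
    rintro c hc rfl
    exact h11 ((infix_blocks_of_mem hc).trans hin)
  have hlen := two_mul_length_le_length_blocks hpos
  obtain ⟨b, hb⟩ := hbs.exists_block_lengths
  have heq := psiW_map_eq_blocks hb
  rw [← heq] at hbs
  have hv := ih _ hbs.of_psiW (by simp at hw ⊢; omega)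
  have := ((isPal_replicate s false).isPalConcat.append
    (hv.psiW_append_true (b := b + 1))).append (isPal_replicate r false).isPalConcat
  rw [heq] at this
  exact this.mono (by omega)

theorem NoConflict.isPalConcat (m : ℕ) :
    ∀ w : List Bool, NoConflict w → w.length ≤ 2 ^ m → IsPalConcat w (3 * m + 1) := by
  induction m with
  | zero =>
    intro w _ hw
    match w, hw with
    | [], _ => exact IsPal.isPalConcat rfl
    | [x], _ => exact IsPal.isPalConcat rfl
    | _ :: _ :: _, hw => simp at hw
  | succ m ih =>
    intro w h hw
    rw [pow_succ'] at hw
    by_cases h11 : [true, true] <:+: w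
    · have h00 : ¬ [true, true] <:+: w.map not := by
        intro h'
        have := h'.map not
        simp only [List.map_cons, List.map_nil, List.map_map, Bool.not_true,
          Function.comp_def, Bool.not_not, List.map_id_fun'] at this
        exact h [] this h11
      have := (h.map_not.isPalConcat_step h00 (by simpa using hw) ih).map not
      simp only [List.map_map, Function.comp_def, Bool.not_not, List.map_id_fun'] at this
      exact this.mono (by omega)
    · exact (h.isPalConcat_step h11 hw ih).mono (by omega)

/-! ### Windows of an infinite word -/

/-- The factor of length `n` of `u` starting at position `i`. -/
def window (u : ℕ → Bool) (n i : ℕ) : List Bool := (List.range n).map fun k => u (i + k)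

section Window

variable {u : ℕ → Bool}

@[simp] theorem length_window (n i : ℕ) : (window u n i).length = n := by simp [window]

theorem window_add (a b i : ℕ) : window u (a + b) i = window u a i ++ window u b (i + a) := by
  simp [window, List.range_add, Function.comp_def, add_assoc]

theorem window_one (i : ℕ) : window u 1 i = [u i] := by simp [window]

theorem window_eq_iff {n i j : ℕ} :
    window u n i = window u n j ↔ ∀ k < n, u (i + k) = u (j + k) := by
  simp [window, List.map_inj_left]

theorem window_succ_eq_iff {n i j : ℕ} :
    window u (n + 1) i = window u (n + 1) j ↔
      window u n i = window u n j ∧ u (i + n) = u (j + n) := by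
  simp only [window_eq_iff]
  exact Nat.forall_lt_succ_right

theorem take_window_succ (n i : ℕ) : (window u (n + 1) i).take n = window u n i := by
  rw [window_add, List.take_left' (length_window n i)]

theorem setOf_factorOf (n : ℕ) :
    {v : List Bool | v.length = n ∧ FactorOf v u} = Set.range (window u n) := by
  ext v
  constructor
  · rintro ⟨rfl, i, hi⟩
    exact ⟨i, hi.symm⟩
  · rintro ⟨i, rfl⟩
    exact ⟨length_window n i, i, by rw [length_window]; rfl⟩

theorem infix_window {n i : ℕ} {x : List Bool} (h : x <:+: window u n i) :
    ∃ j, x = window u x.length j := by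
  obtain ⟨s, t, hst⟩ := h
  have hn : n = s.length + (x.length + t.length) := by
    have := congrArg List.length hst
    simp at this
    omega
  rw [hn, window_add, window_add, List.append_assoc] at hst
  have h1 := List.append_inj hst (by simp)
  exact ⟨_, (List.append_inj h1.2 (by simp)).1⟩

theorem Sturmian.ncard_range (hu : Sturmian u) (n : ℕ) :
    (Set.range (window u n)).ncard = n + 1 := by
  rw [← setOf_factorOf]
  exact hu n

theorem Sturmian.finite_range (hu : Sturmian u) (n : ℕ) : (Set.range (window u n)).Finite :=
  Set.finite_of_ncard_ne_zero (by rw [hu.ncard_range]; omega)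

/-! ### Right special factors -/

/-- The factor of length `n` at position `i` has two different right extensions. -/
def RightSpecial (u : ℕ → Bool) (n i : ℕ) : Prop :=
  ∃ j, window u n j = window u n i ∧ u (j + n) ≠ u (i + n)

theorem image_take_range_window (n : ℕ) :
    List.take n '' Set.range (window u (n + 1)) = Set.range (window u n) := by
  rw [← Set.range_comp]
  congr 1
  funext i
  exact take_window_succ n i

theorem Sturmian.exists_rightSpecial (hu : Sturmian u) (n : ℕ) : ∃ i, RightSpecial u n i := by
  by_contra! hcon
  have hinj : Set.InjOn (List.take n) (Set.range (window u (n + 1))) := by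
    rintro _ ⟨i, rfl⟩ _ ⟨j, rfl⟩ hij
    rw [take_window_succ, take_window_succ] at hij
    by_contra hne
    exact hcon j ⟨i, hij, fun h => hne (window_succ_eq_iff.2 ⟨hij, h⟩)⟩
  have := hinj.ncard_image
  rw [image_take_range_window, hu.ncard_range, hu.ncard_range] at this
  omega

theorem Sturmian.rightSpecial_unique (hu : Sturmian u) {n i j : ℕ} (hi : RightSpecial u n i)
    (hj : RightSpecial u n j) : window u n i = window u n j := by
  by_contra hne
  obtain ⟨i', hi', hi2⟩ := hi
  obtain ⟨j', hj', hj2⟩ := hj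
  set G := Set.range (window u (n + 1))
  set a := window u (n + 1) i
  set b := window u (n + 1) j
  have hab : a ≠ b := fun h => hne (window_succ_eq_iff.1 h).1
  have hsub : Set.range (window u n) ⊆ List.take n '' (G \ {a, b}) := by
    rintro _ ⟨t, rfl⟩
    have key : ∃ s, window u n s = window u n t ∧ window u (n + 1) s ≠ a ∧
        window u (n + 1) s ≠ b := by
      by_cases hta : window u (n + 1) t = a
      · have := (window_succ_eq_iff.1 hta).1
        refine ⟨i', hi'.trans this.symm, fun h => hi2 (window_succ_eq_iff.1 h).2, fun h => ?_⟩
        exact hne (hi'.symm.trans (window_succ_eq_iff.1 h).1)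
      by_cases htb : window u (n + 1) t = b
      · have := (window_succ_eq_iff.1 htb).1
        refine ⟨j', hj'.trans this.symm, fun h => ?_, fun h => hj2 (window_succ_eq_iff.1 h).2⟩
        exact hne ((window_succ_eq_iff.1 h).1.symm.trans hj')
      exact ⟨t, rfl, hta, htb⟩
    obtain ⟨s, hs, hsa, hsb⟩ := key
    exact ⟨window u (n + 1) s, ⟨⟨s, rfl⟩, by simp [hsa, hsb]⟩, by rw [take_window_succ, hs]⟩
  have hfin : (G \ {a, b}).Finite := (hu.finite_range (n + 1)).sdiff
  have h1 := (Set.ncard_le_ncard hsub (hfin.image _)).trans (Set.ncard_image_le hfin)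
  have h2 : (G \ {a, b}).ncard = G.ncard - ({a, b} : Set (List Bool)).ncard :=
    Set.ncard_sdiff (by rintro x (rfl | rfl) <;> exact ⟨_, rfl⟩) (Set.toFinite _)
  have hG : G.ncard = n + 1 + 1 := hu.ncard_range (n + 1)
  rw [Set.ncard_pair hab, hG] at h2
  rw [hu.ncard_range] at h1
  omega

theorem Sturmian.not_eventually_periodic (hu : Sturmian u) {p q : ℕ} (hpq : p < q) :
    ¬ ∀ k, u (p + k) = u (q + k) := by
  intro h
  have hsub : Set.range (window u q) ⊆ (window u q) '' (Finset.range q : Set ℕ) := by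
    rintro _ ⟨r, rfl⟩
    induction r using Nat.strong_induction_on with
    | _ r ih =>
      by_cases hr : r < q
      · exact ⟨r, by simpa using hr, rfl⟩
      · have heq : window u q r = window u q (p + (r - q)) := by
          rw [window_eq_iff]
          intro k _
          have := h (r - q + k)
          rw [← add_assoc, ← add_assoc, Nat.add_sub_cancel' (not_lt.1 hr)] at this
          exact this.symm
        rw [heq]
        exact ih _ (by omega)
  have h1 := Set.ncard_le_ncard hsub ((Finset.finite_toSet _).image _)
  have h2 := Set.ncard_image_le (f := window u q) (Finset.finite_toSet (Finset.range q))
  rw [hu.ncard_range] at h1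
  rw [Set.ncard_coe_finset, Finset.card_range] at h2
  omega

/-- In a Sturmian word, there is no palindrome `w` such that `cwc` and `dwd` are factors, where
`d` is the other letter, and `dw` is right special. -/
theorem Sturmian.not_conflict_of_rightSpecial (hu : Sturmian u) {m i j : ℕ}
    (hij : u i ≠ u j) (hi : u (i + (m + 1)) = u i)
    (heq : ∀ k < m, u (i + 1 + k) = u (j + 1 + k))
    (hpal : ∀ k < m, u (i + 1 + k) = u (i + (m - k)))
    (hj : RightSpecial u (m + 1) j) : False := by
  have hne : ∀ t ≤ m + 1, window u (m + 1) (i + t) ≠ window u (m + 1) j := by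
    intro t ht h
    rw [window_eq_iff] at h
    have h0 := h 0 (by omega)
    rcases Nat.eq_zero_or_pos t with rfl | htpos
    · exact hij h0
    rcases Nat.lt_or_ge m t with htm | htm
    · obtain rfl : t = m + 1 := by omega
      exact hij (hi.symm.trans h0)
    have h1 := h (m + 1 - t) (by omega)
    have h2 := heq (m - t) (by omega)
    have h3 := hpal (m - t) (by omega)
    rw [show i + t + (m + 1 - t) = i + (m + 1) by omega, hi,
      show j + (m + 1 - t) = j + 1 + (m - t) by omega, ← h2, h3,
      show i + (m - (m - t)) = i + t + 0 by omega, h0] at h1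
    exact hij h1
  have hpigeon : ∃ p q, p < q ∧ q ≤ m + 1 ∧
      window u (m + 1) (i + p) = window u (m + 1) (i + q) := by
    have hfin : (Set.range (window u (m + 1)) \ {window u (m + 1) j}).Finite :=
      (hu.finite_range (m + 1)).sdiff
    have hcard : hfin.toFinset.card < (Finset.range (m + 2)).card := by
      rw [← Set.ncard_eq_toFinset_card _ hfin, Set.ncard_sdiff_singleton_of_mem (Set.mem_range_self j),
        hu.ncard_range, Finset.card_range]
      omega
    obtain ⟨p, hp, q, hq, hpq, he⟩ := Finset.exists_ne_map_eq_of_card_lt_of_maps_to hcard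
      (f := fun t => window u (m + 1) (i + t)) (by
        intro t ht
        rw [Finset.mem_coe, Finset.mem_range] at ht
        rw [Finset.mem_coe, Set.Finite.mem_toFinset]
        exact ⟨⟨_, rfl⟩, hne t (by omega)⟩)
    rw [Finset.mem_range] at hp hq
    rcases lt_or_gt_of_ne hpq with h | h
    · exact ⟨p, q, h, by omega, he⟩
    · exact ⟨q, p, h, by omega, he.symm⟩
  obtain ⟨p, q, hpq, hq, he⟩ := hpigeon
  have hmain : ∀ k, window u (m + 1) (i + p + k) = window u (m + 1) (i + q + k) ∧
      window u (m + 1) (i + p + k) ≠ window u (m + 1) j := by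
    intro k
    induction k using Nat.strong_induction_on with
    | _ k ih =>
      constructor
      · rcases k with _ | k
        · exact he
        · obtain ⟨h1, h2⟩ := ih k (by omega)
          have h3 : u (i + p + k + (m + 1)) = u (i + q + k + (m + 1)) := by
            by_contra hcon
            exact h2 (hu.rightSpecial_unique ⟨i + q + k, h1.symm, fun h => hcon h.symm⟩ hj)
          have h4 := window_succ_eq_iff.2 ⟨h1, h3⟩
          rw [window_eq_iff] at h4 ⊢
          intro l hl
          have := h4 (l + 1) (by omega)
          rw [show i + p + (k + 1) + l = i + p + k + (l + 1) by omega,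
            show i + q + (k + 1) + l = i + q + k + (l + 1) by omega]
          exact this
      · rcases Nat.lt_or_ge (m + 1) (p + k) with hk | hk
        · obtain ⟨h1, h2⟩ := ih (p + k - q) (by omega)
          rw [show i + q + (p + k - q) = i + p + k by omega] at h1
          rwa [← h1]
        · rw [add_assoc]
          exact hne _ hk
  refine hu.not_eventually_periodic (p := i + p) (q := i + q) (by omega) fun k => ?_
  exact window_eq_iff.1 (hmain k).1 0 (by omega)

theorem Sturmian.not_palindromic_conflict (hu : Sturmian u) {m i j : ℕ}
    (hij : u i ≠ u j) (hi : u (i + (m + 1)) = u i) (hj : u (j + (m + 1)) = u j)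
    (heq : ∀ k < m, u (i + 1 + k) = u (j + 1 + k))
    (hpal : ∀ k < m, u (i + 1 + k) = u (i + (m - k))) : False := by
  obtain ⟨s, hs⟩ := hu.exists_rightSpecial (m + 1)
  have hs' : RightSpecial u m (s + 1) := by
    obtain ⟨t, ht, ht'⟩ := hs
    refine ⟨t + 1, ?_, by rwa [add_right_comm t, add_right_comm s]⟩
    rw [window_eq_iff] at ht ⊢
    intro k hk
    have := ht (k + 1) (by omega)
    rwa [← add_assoc, ← add_assoc, add_right_comm t, add_right_comm s] at this
  have hw : RightSpecial u m (i + 1) := by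
    refine ⟨j + 1, (window_eq_iff.2 heq).symm, ?_⟩
    rw [add_assoc, add_assoc, add_comm 1 m, hi, hj]
    exact hij.symm
  have hsw := window_eq_iff.1 (hu.rightSpecial_unique hs' hw)
  have transfer : ∀ t, u s = u t → (∀ k < m, u (i + 1 + k) = u (t + 1 + k)) →
      RightSpecial u (m + 1) t := by
    intro t h0 ht
    have hst : window u (m + 1) s = window u (m + 1) t := by
      rw [window_eq_iff]
      rintro (_ | k) hk
      · exact h0
      · rw [add_comm k 1, ← add_assoc, ← add_assoc, hsw k (by omega), ht k (by omega)]
    obtain ⟨r, hr, hr'⟩ := hs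
    by_cases h : u (r + (m + 1)) = u (t + (m + 1))
    · exact ⟨s, hst, fun h' => hr' (h.trans h'.symm)⟩
    · exact ⟨r, hr.trans hst, h⟩
  by_cases hsj : u s = u j
  · exact hu.not_conflict_of_rightSpecial hij hi heq hpal (transfer j hsj heq)
  · have hsi : u s = u i := by
      revert hsj hij
      cases u s <;> cases u i <;> cases u j <;> simp
    refine hu.not_conflict_of_rightSpecial hij.symm hj (fun k hk => (heq k hk).symm) ?_
      (transfer i hsi fun _ _ => rfl)
    intro k hk
    have h1 := heq (m - 1 - k) (by omega)
    rw [← heq k hk, hpal k hk]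
    rw [show i + 1 + (m - 1 - k) = i + (m - k) by omega,
      show j + 1 + (m - 1 - k) = j + (m - k) by omega] at h1
    exact h1

/-! ### Balance -/

theorem count_window_succ (n i : ℕ) :
    (window u (n + 1) i).count true = (window u n i).count true + (u (i + n)).toNat := by
  rw [window_add, List.count_append, window_one]
  cases u (i + n) <;> simp

theorem count_window_add (a b i : ℕ) : (window u (a + b) i).count true =
    (window u a i).count true + (window u b (i + a)).count true := by
  rw [window_add, List.count_append]

theorem Sturmian.balanced (hu : Sturmian u) (n : ℕ) :
    ∀ i j, (window u n i).count true ≤ (window u n j).count true + 1 := by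
  induction n using Nat.strong_induction_on with
  | _ n ih =>
  intro i j
  by_contra! hcon
  have hmid : ∀ k, 0 < k → k < n →
      (window u k i).count true = (window u k j).count true + 1 := by
    intro k hk hkn
    have h1 := ih k hkn i j
    have h2 := ih (n - k) (by omega) (i + k) (j + k)
    have h3 := count_window_add (u := u) k (n - k) i
    have h4 := count_window_add (u := u) k (n - k) j
    rw [Nat.add_sub_cancel' hkn.le] at h3 h4
    omega
  obtain ⟨m, rfl⟩ : ∃ m, n = m + 2 := by
    rcases n with _ | _ | m
    · simp [window] at hcon
    · have h3 := List.count_le_length (a := true) (l := window u (0 + 1) i)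
      rw [length_window] at h3
      omega
    · exact ⟨m, rfl⟩
  have hfirst : u i = true ∧ u j = false := by
    have := hmid 1 (by omega) (by omega)
    rw [window_one, window_one] at this
    revert this
    cases u i <;> cases u j <;> simp
  have hlast : u (i + (m + 1)) = true ∧ u (j + (m + 1)) = false := by
    have := hmid (m + 1) (by omega) (by omega)
    rw [count_window_succ (m + 1) i, count_window_succ (m + 1) j, this] at hcon
    revert hcon
    cases u (i + (m + 1)) <;> cases u (j + (m + 1)) <;> simp
  have heq : ∀ k < m, u (i + 1 + k) = u (j + 1 + k) := by
    intro k hk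
    have h1 := hmid (k + 1) (by omega) (by omega)
    have h2 := hmid (k + 1 + 1) (by omega) (by omega)
    rw [count_window_succ (k + 1) i, count_window_succ (k + 1) j, h1] at h2
    rw [show i + 1 + k = i + (k + 1) by omega, show j + 1 + k = j + (k + 1) by omega]
    revert h2
    cases u (i + (k + 1)) <;> cases u (j + (k + 1)) <;> simp
  have hends : ∀ k ≤ m, (window u k (i + 1)).count true =
      (window u k (i + (m + 1 - k))).count true := by
    intro k hk
    have h1 := ih (k + 1) (by omega) i (j + (m + 1 - k))
    have h2 := ih (k + 1) (by omega) (i + (m + 1 - k)) j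
    have h3 : window u k (i + 1) = window u k (j + 1) :=
      window_eq_iff.2 fun l hl => heq l (by omega)
    have h4 : window u k (i + (m + 1 - k)) = window u k (j + (m + 1 - k)) := by
      refine window_eq_iff.2 fun l hl => ?_
      have := heq (m - k + l) (by omega)
      rwa [show i + 1 + (m - k + l) = i + (m + 1 - k) + l by omega,
        show j + 1 + (m - k + l) = j + (m + 1 - k) + l by omega] at this
    rw [count_window_succ k (j + (m + 1 - k)), show j + (m + 1 - k) + k = j + (m + 1) by omega, hlast.2, ← h4,
      add_comm k 1, count_window_add, window_one, hfirst.1] at h1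
    rw [count_window_succ k (i + (m + 1 - k)), show i + (m + 1 - k) + k = i + (m + 1) by omega, hlast.1,
      add_comm k 1, count_window_add 1 k j, window_one, hfirst.2, ← h3] at h2
    simp at h1 h2
    omega
  have hpal : ∀ k < m, u (i + 1 + k) = u (i + (m - k)) := by
    intro k hk
    have h1 := hends k (by omega)
    have h2 := hends (k + 1) (by omega)
    rw [count_window_succ, h1, add_comm k 1, count_window_add, window_one,
      show i + (m + 1 - (1 + k)) = i + (m - k) by omega,
      show i + (m - k) + 1 = i + (m + 1 - k) by omega] at h2
    revert h2
    cases u (i + 1 + k) <;> cases u (i + (m - k)) <;> simp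
  exact hu.not_palindromic_conflict (by simp [hfirst]) (by rw [hlast.1, hfirst.1])
    (by rw [hlast.2, hfirst.2]) heq hpal

theorem Sturmian.noConflict_window (hu : Sturmian u) (n i : ℕ) : NoConflict (window u n i) := by
  intro z h0 h1
  obtain ⟨a, ha⟩ := infix_window h0
  obtain ⟨b, hb⟩ := infix_window h1
  have := hu.balanced (z.length + 2) b a
  simp only [List.length_cons, List.length_append, List.length_nil, zero_add] at ha hb
  rw [← ha, ← hb] at this
  simp at this

theorem Sturmian.PL_le (hu : Sturmian u) {n m : ℕ} (h : n ≤ 2 ^ m) : PL u n ≤ 3 * m + 1 := by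
  refine csSup_le' ?_
  rintro k ⟨v, rfl, ⟨i, hi⟩, rfl⟩
  have hv : NoConflict v := by
    rw [hi]
    exact hu.noConflict_window _ _
  exact (hv.isPalConcat m v h).palLen_le

end Window

theorem stmt12 :
    ∃ K : ℝ, 0 < K ∧ ∀ u : ℕ → Bool, Sturmian u →
      ∀ n : ℕ, 2 ≤ n → (PL u n : ℝ) ≤ K * Real.log n := by
  have hlog2 : 0 < Real.log 2 := Real.log_pos one_lt_two
  refine ⟨7 / Real.log 2, by positivity, fun u hu n hn => ?_⟩
  have h1 : PL u n ≤ 3 * (Nat.log 2 n + 1) + 1 :=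
    hu.PL_le (Nat.lt_pow_succ_log_self one_lt_two n).le
  have h2 : 1 ≤ Nat.log 2 n := Nat.log_pos one_lt_two hn
  have h3 : (PL u n : ℝ) ≤ 7 * (Nat.log 2 n : ℝ) := by
    exact_mod_cast (show PL u n ≤ 7 * Nat.log 2 n by omega)
  have h4 : (Nat.log 2 n : ℝ) * Real.log 2 ≤ Real.log n := by
    rw [← Real.log_pow]
    refine Real.log_le_log (by positivity) ?_
    exact_mod_cast Nat.pow_log_le_self 2 (by omega)
  rw [div_mul_eq_mul_div, le_div_iff₀ hlog2]
  nlinarith
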